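/- (Bounding Lemma, local deadlocks, disjunctive, fair.) For disjunctive systems with process templates A,B, G = G_A ∪ G_B, and n ≥ |B| + |G| + 1, restricted to strong-fair runs: if (A,B)^(1,n) has a strong-fair locally deadlocked run, then (A,B)^(1,|B|+|G|+1) has a strong-fair locally deadlocked run. -/

import Mathlib

namespace GP

/-- A process template: an initial state and a guarded transition relation.
`Gd` is the type of guards. -/
structure Template (Q Sig Gd : Type) where
  init : Q
  trans : Set (Q × Sig × Gd × Q)

variable {QA QB SA SB Gd : Type}

/-- Processes of `(A,B)^{(1,n)}`: `none` is the `A`-process, `some i` is `B_i`. -/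
abbrev Proc (n : ℕ) := Option (Fin n)
/-- A global state. -/
abbrev GState (QA QB : Type) (n : ℕ) := QA × (Fin n → QB)
/-- A global input. -/
abbrev GInput (SA SB : Type) (n : ℕ) := SA × (Fin n → SB)

/-- The local state of process `p` in global state `s`. -/
def view {n : ℕ} (s : GState QA QB n) : Proc n → QA ⊕ QB
  | none => Sum.inl s.1
  | some i => Sum.inr (s.2 i)

/-- The local input of process `p` in global input `e`. -/
def inp {n : ℕ} (e : GInput SA SB n) : Proc n → SA ⊕ SB
  | none => Sum.inl e.1
  | some i => Sum.inr (e.2 i)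

/-- The set of local states of the processes other than `p`. -/
def others {n : ℕ} (s : GState QA QB n) (p : Proc n) : Set (QA ⊕ QB) :=
  {x | ∃ p', p' ≠ p ∧ view s p' = x}

/-- Disjunctive interpretation of guards: some other process is in the guard. -/
def disjSat (S : Set (QA ⊕ QB)) (g : Set (QA ⊕ QB)) : Prop := ∃ x ∈ S, x ∈ g
/-- Conjunctive interpretation of guards: every other process is in the guard. -/
def conjSat (S : Set (QA ⊕ QB)) (g : Set (QA ⊕ QB)) : Prop := ∀ x ∈ S, x ∈ g
/-- Conjunction-of-disjunctive-guards interpretation: a guard is a finite set of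
disjunctive conjuncts, each of which must be witnessed by some other process. -/
def cdSat (S : Set (QA ⊕ QB)) (g : Set (Set (QA ⊕ QB))) : Prop := ∀ D ∈ g, ∃ x ∈ S, x ∈ D

section System

variable (A : Template QA SA Gd) (B : Template QB SB Gd)
variable (sat : Set (QA ⊕ QB) → Gd → Prop)

/-- Process `p` is enabled for global state `s` and input `e`. -/
def enabled {n : ℕ} (s : GState QA QB n) (e : GInput SA SB n) : Proc n → Prop
  | none => ∃ g q', (s.1, e.1, g, q') ∈ A.trans ∧ sat (others s none) g
  | some i => ∃ g q', (s.2 i, e.2 i, g, q') ∈ B.trans ∧ sat (others s (some i)) g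

/-- One interleaving step of the system, performed by process `p`. -/
def step {n : ℕ} (s : GState QA QB n) (e : GInput SA SB n) : Proc n → GState QA QB n → Prop
  | none, s' => ∃ g q', (s.1, e.1, g, q') ∈ A.trans ∧ sat (others s none) g ∧ s' = (q', s.2)
  | some i, s' => ∃ g q', (s.2 i, e.2 i, g, q') ∈ B.trans ∧ sat (others s (some i)) g ∧
      s' = (s.1, Function.update s.2 i q')

/-- The global initial state. -/
def isInit {n : ℕ} (s : GState QA QB n) : Prop := s.1 = A.init ∧ ∀ i, s.2 i = B.init

/-- An infinite run of `(A,B)^{(1,n)}`: at each moment `t` process `mv t` makes a step,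
and the input of a process stays unchanged until that process moves. -/
structure Run (n : ℕ) where
  s : ℕ → GState QA QB n
  e : ℕ → GInput SA SB n
  mv : ℕ → Proc n
  isInit0 : isInit A B (s 0)
  steps : ∀ t, step A B sat (s t) (e t) (mv t) (s (t + 1))
  persist : ∀ t p, p ≠ mv t → inp (e (t + 1)) p = inp (e t) p

/-- The run `x` is locally deadlocked for process `p`. -/
def lockedFrom {n : ℕ} (x : Run A B sat n) (p : Proc n) : Prop :=
  ∃ t0, ∀ t ≥ t0, ¬ enabled A B sat (x.s t) (x.e t) p

/-- The run `x` is locally deadlocked for the `B`-process `i`, which is stuck in state `q`. -/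
def lockedInState {n : ℕ} (x : Run A B sat n) (i : Fin n) (q : QB) : Prop :=
  ∃ t0, ∀ t ≥ t0, ¬ enabled A B sat (x.s t) (x.e t) (some i) ∧ (x.s t).2 i = q

/-- `(A,B)^{(1,n)}` has a local deadlock. -/
def hasLocalDeadlock (n : ℕ) : Prop :=
  ∃ x : Run A B sat n, ∃ p, lockedFrom A B sat x p

/-- `(A,B)^{(1,n)}` has a global deadlock: a finite maximal path (a finite run) ending
in a configuration where no process is enabled. -/
def hasGlobalDeadlock (n : ℕ) : Prop :=
  ∃ (m : ℕ) (s : ℕ → GState QA QB n) (e : ℕ → GInput SA SB n) (mv : ℕ → Proc n),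
    isInit A B (s 0) ∧
    (∀ t < m, step A B sat (s t) (e t) (mv t) (s (t + 1))) ∧
    (∀ t < m, ∀ p, p ≠ mv t → inp (e (t + 1)) p = inp (e t) p) ∧
    ∀ p, ¬ enabled A B sat (s m) (e m) p

/-- Unconditional fairness: every process moves infinitely often. -/
def uncondFair {n : ℕ} (x : Run A B sat n) : Prop :=
  ∀ p, ∀ t, ∃ t' ≥ t, x.mv t' = p

/-- Strong fairness: every process enabled infinitely often moves infinitely often. -/
def strongFair {n : ℕ} (x : Run A B sat n) : Prop :=
  ∀ p, (∀ t, ∃ t' ≥ t, enabled A B sat (x.s t') (x.e t') p) → (∀ t, ∃ t' ≥ t, x.mv t' = p)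

/-- Initializing run: every process that moves infinitely often visits its
initial state infinitely often. -/
def initializing {n : ℕ} (x : Run A B sat n) : Prop :=
  ∀ p, (∀ t, ∃ t' ≥ t, x.mv t' = p) →
    ∀ t, ∃ t' ≥ t, view (x.s t') p = (match p with
      | none => Sum.inl A.init
      | some _ => Sum.inr B.init)

end System

/-- LTL without the next-time operator (`LTL\X`). -/
inductive LTL (P : Type) : Type
  | atom : P → LTL P
  | tru : LTL P
  | not : LTL P → LTL P
  | and : LTL P → LTL P → LTL P
  | untl : LTL P → LTL P → LTL P

/-- Semantics of `LTL\X` over a trace `w` of valuations. -/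
def LTL.holds {P : Type} (w : ℕ → P → Prop) : LTL P → ℕ → Prop
  | .atom a, t => w t a
  | .tru, _ => True
  | .not f, t => ¬ LTL.holds w f t
  | .and f g, t => LTL.holds w f t ∧ LTL.holds w g t
  | .untl f g, t => ∃ t', t ≤ t' ∧ LTL.holds w g t' ∧ ∀ u, t ≤ u → u < t' → LTL.holds w f u

/-- Atomic propositions of a `k`-indexed formula `h(A, B_{i_1}, …, B_{i_k})`:
states/inputs of `A` and indexed states/inputs of `k` `B`-processes. -/
abbrev AtomK (QA SA QB SB : Type) (k : ℕ) := (QA ⊕ SA) ⊕ ((QB ⊕ SB) × Fin k)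

section Spec

variable (A : Template QA SA Gd) (B : Template QB SB Gd)
variable (sat : Set (QA ⊕ QB) → Gd → Prop)

/-- The trace of valuations of the atomic propositions along run `x`, where the `k`
indexed `B`-processes are given by `ι`. -/
def traceK {n k : ℕ} (x : Run A B sat n) (ι : Fin k → Fin n) :
    ℕ → AtomK QA SA QB SB k → Prop := fun t a =>
  match a with
  | Sum.inl (Sum.inl qa) => (x.s t).1 = qa
  | Sum.inl (Sum.inr sa) => (x.e t).1 = sa
  | Sum.inr (Sum.inl qb, i) => (x.s t).2 (ι i) = qb
  | Sum.inr (Sum.inr sb, i) => (x.e t).2 (ι i) = sb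

/-- `(A,B)^{(1,n)} ⊨ ∀ i_1,…,i_k. E h`, relative to a fairness constraint `F` on runs. -/
def satE (k n : ℕ) (F : Run A B sat n → Prop) (h : LTL (AtomK QA SA QB SB k)) : Prop :=
  ∀ ι : Fin k ↪ Fin n, ∃ x : Run A B sat n, F x ∧ LTL.holds (traceK A B sat x ι) h 0

/-- `(A,B)^{(1,n)} ⊨ ∀ i_1,…,i_k. A h`, relative to a fairness constraint `F` on runs. -/
def satA (k n : ℕ) (F : Run A B sat n → Prop) (h : LTL (AtomK QA SA QB SB k)) : Prop :=
  ∀ ι : Fin k ↪ Fin n, ∀ x : Run A B sat n, F x → LTL.holds (traceK A B sat x ι) h 0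

/-- `c` is a cutoff for `k`-indexed `LTL\X` properties (w.r.t. fairness `F`). -/
def kCutoff (F : ∀ n, Run A B sat n → Prop) (k c : ℕ) : Prop :=
  ∀ (h : LTL (AtomK QA SA QB SB k)) (n : ℕ), c ≤ n →
    ((satE A B sat k n (F n) h ↔ satE A B sat k c (F c) h) ∧
     (satA A B sat k n (F n) h ↔ satA A B sat k c (F c) h))

end Spec

/-- All guards appearing in transitions of a template. -/
def guardsOf {Q Sig Gd : Type} (T : Template Q Sig Gd) : Set Gd :=
  {g | ∃ q σ q', (q, σ, g, q') ∈ T.trans}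

/-- The non-trivial guards of a template (different from `Q_A ∪ Q_B` and `∅`). -/
def ntGuards {Q Sig St : Type} (T : Template Q Sig (Set St)) : Set (Set St) :=
  {g | g ∈ guardsOf T ∧ g ≠ Set.univ ∧ g ≠ ∅}

/-- `|G| = |G_A ∪ G_B|`, the number of non-trivial guards of the system. -/
noncomputable def numG (A : Template QA SA (Set (QA ⊕ QB))) (B : Template QB SB (Set (QA ⊕ QB))) : ℕ :=
  (ntGuards A ∪ ntGuards B).ncard

/-- `Enable_q`: the states of `A` and `B` that enable some transition from `q` in `B`. -/
def EnableSet (B : Template QB SB (Set (QA ⊕ QB))) (q : QB) : Set (QA ⊕ QB) :=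
  {x | ∃ σ g q'', (q, σ, g, q'') ∈ B.trans ∧ x ∈ g}

section Conj

variable (A : Template QA SA (Set (QA ⊕ QB))) (B : Template QB SB (Set (QA ⊕ QB)))

/-- The standing assumption on conjunctive systems: `init_A` and `init_B`
are contained in all guards. -/
def conjInitAssumption : Prop :=
  ∀ g ∈ guardsOf A ∪ guardsOf B, Sum.inl A.init ∈ g ∧ Sum.inr B.init ∈ g

/-- The guards of the transitions from a local state of the system. -/
def guardsFrom : QA ⊕ QB → Set (Set (QA ⊕ QB))
  | Sum.inl q => {g | ∃ σ q', (q, σ, g, q') ∈ A.trans}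
  | Sum.inr q => {g | ∃ σ q', (q, σ, g, q') ∈ B.trans}

/-- `D` is a deadset of state `st` (contains at most one `A`-state, hits every guard of a
transition from `st`, and each of its members violates some guard from `st`). -/
def IsDeadset (st : QA ⊕ QB) (D : Set (QA ⊕ QB)) : Prop :=
  (∀ x ∈ D, ∀ y ∈ D, x.isLeft → y.isLeft → x = y) ∧
  (∀ g ∈ guardsFrom A B st, ∃ x ∈ D, x ∉ g) ∧
  (∀ x ∈ D, ∃ g ∈ guardsFrom A B st, x ∉ g)

/-- A state is free if it has no deadset. -/
def IsFreeState (st : QA ⊕ QB) : Prop := ¬ ∃ D, IsDeadset A B st D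

/-- A state is non-blocking if it appears in no deadset of any state. -/
def IsNonBlocking (x : QA ⊕ QB) : Prop := ∀ st D, IsDeadset A B st D → x ∉ D

/-- A state is not self-blocking if it appears in no deadset of itself. -/
def IsNotSelfBlocking (st : QA ⊕ QB) : Prop := ∀ D, IsDeadset A B st D → st ∉ D

/-- A locally deadlocked run that is alternation-free: eventually one single deadset of the
deadlocked state remains covered forever (no infinite alternation between deadsets). -/
def altFreeLockedRun {n : ℕ} (x : Run A B conjSat n) (p : Proc n) : Prop :=
  ∃ t0 D, (∀ t ≥ t0, ¬ enabled A B conjSat (x.s t) (x.e t) p) ∧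
    IsDeadset A B (view (x.s t0) p) D ∧ ∀ t ≥ t0, D ⊆ others (x.s t) p

end Conj

section UProps

variable {QU SU : Type}
variable (U : Template QU SU (Set (QA ⊕ QB))) (emb : QU → QA ⊕ QB)

/-- Guards of transitions from state `q` of template `U`. -/
def uGFrom (q : QU) : Set (Set (QA ⊕ QB)) := {g | ∃ σ q', (q, σ, g, q') ∈ U.trans}

/-- A deadset of state `q` of template `U`. -/
def uDeadset (q : QU) (D : Set (QA ⊕ QB)) : Prop :=
  (∀ x ∈ D, ∀ y ∈ D, x.isLeft → y.isLeft → x = y) ∧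
  (∀ g ∈ uGFrom U q, ∃ x ∈ D, x ∉ g) ∧
  (∀ x ∈ D, ∃ g ∈ uGFrom U q, x ∉ g)

/-- A state of `U` is free if it has no deadset. -/
def uFreeState (q : QU) : Prop := ¬ ∃ D, uDeadset U q D

/-- A `1`-conjunctive guard excludes exactly one state. -/
def OneConjGuard (g : Set (QA ⊕ QB)) : Prop := ∃ x : QA ⊕ QB, g = {x}ᶜ

/-- A state is `1`-conjunctive if all its non-trivial guards are `1`-conjunctive. -/
def uOneConjState (q : QU) : Prop :=
  ∀ g ∈ uGFrom U q, g ≠ Set.univ → g ≠ ∅ → OneConjGuard g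

/-- A template is `1`-conjunctive if all its states are. -/
def uOneConj : Prop := ∀ q : QU, uOneConjState U q

/-- Effectively `1`-conjunctive: every state is `1`-conjunctive or free. -/
def uEff1Conj : Prop := ∀ q : QU, uOneConjState U q ∨ uFreeState U q

/-- Transitions of `U`, as quadruples. -/
abbrev Edge (QU SU St : Type) := QU × SU × Set St × QU

def esrc {St : Type} (e : Edge QU SU St) : QU := e.1
def etgt {St : Type} (e : Edge QU SU St) : QU := e.2.2.2
def egrd {St : Type} (e : Edge QU SU St) : Set St := e.2.2.1

/-- A connected sequence of transitions of `U`. -/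
def uEPath (l : List (Edge QU SU (QA ⊕ QB))) : Prop :=
  (∀ e ∈ l, e ∈ U.trans) ∧ l.Chain' (fun e e' => etgt e = esrc e')

/-- A cycle through `q`: a nonempty connected transition sequence from `q` back to `q`
visiting pairwise distinct states. -/
def uIsCycle (q : QU) (l : List (Edge QU SU (QA ⊕ QB))) : Prop :=
  l ≠ [] ∧ uEPath U l ∧
  (∃ e0 ∈ l.head?, esrc e0 = q) ∧ (∃ en ∈ l.getLast?, etgt en = q) ∧
  (l.map esrc).Nodup

/-- The states on a cycle (or transition sequence). -/
def cycStates {St : Type} (l : List (Edge QU SU St)) : Set QU := {s | ∃ e ∈ l, esrc e = s}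

/-- The guards on a cycle (or transition sequence). -/
def cycGuards {St : Type} (l : List (Edge QU SU St)) : Set (Set St) := {g | ∃ e ∈ l, egrd e = g}

/-- A lasso: a connected transition sequence starting at the initial state and
ending with a cycle. -/
def uIsLasso (l : List (Edge QU SU (QA ⊕ QB))) : Prop :=
  uEPath U l ∧ (∃ e0 ∈ l.head?, esrc e0 = U.init) ∧
  ∃ l1 l2 q, l = l1 ++ l2 ∧ uIsCycle U q l2

/-- `D` disables all `n`-conjunctive guards with `n > 1` of transitions from `q`. -/
def uDisablesBig (q : QU) (D : Set (QA ⊕ QB)) : Prop :=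
  ∀ g ∈ uGFrom U q, g ≠ Set.univ → 2 ≤ (gᶜ).ncard → ∃ x ∈ D, x ∉ g

/-- Freely traversable template: for every non-free state `q` and every set of states
disabling the `n`-conjunctive guards (`n > 1`) from `q`, there is a lasso whose guards
avoid `¬q`, avoid all `¬q_i`, and avoid all `1`-conjunctive guards from `q`. -/
def uFreelyTraversable : Prop :=
  ∀ q : QU, ¬ uFreeState U q → ∀ D, uDisablesBig U q D →
    ∃ l, uIsLasso U l ∧ ∀ g ∈ cycGuards l,
      emb q ∈ g ∧ (∀ x ∈ D, x ∈ g) ∧ ∀ x : QA ⊕ QB, ({x}ᶜ ∈ uGFrom U q) → x ∈ g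

/-- `x` has a cycle through it that is disjoint from all cycles through `q` and
whose guards never exclude `q`. -/
def uBadCycleFor (q : QU) (x : QA ⊕ QB) : Prop :=
  ∃ qx : QU, emb qx = x ∧ ∃ c, uIsCycle U qx c ∧
    (∀ s ∈ cycStates c, ¬ ∃ cq, uIsCycle U q cq ∧ s ∈ cycStates cq) ∧
    (∀ g ∈ cycGuards c, emb q ∈ g)

/-- Alternation-free template. -/
def uAltFree : Prop :=
  (∀ q : QU, ¬ uFreeState U q → ∀ D, uDisablesBig U q D →
    ∀ x ∈ D, ∀ y ∈ D, uBadCycleFor U emb q x → uBadCycleFor U emb q y → x = y) ∨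
  (∀ q : QU, ¬ uFreeState U q → ∀ g ∈ uGFrom U q, 2 ≤ (gᶜ).ncard →
    ∃ x ∈ gᶜ, {x}ᶜ ∈ uGFrom U q)

end UProps


section Fairness

variable {A : Template QA SA (Set (QA ⊕ QB))} {B : Template QB SB (Set (QA ⊕ QB))} {n : ℕ}

/-- A sequence of configurations in which some moments are idle contains a run, obtained by
skipping the idle moments. -/
theorem exists_run_of_idling (s : ℕ → GState QA QB n) (e : ℕ → GInput SA SB n)
    (mv : ℕ → Proc n) (P : ℕ → Prop) (h_init : isInit A B (s 0))
    (h_step : ∀ t, P t → step A B disjSat (s t) (e t) (mv t) (s (t + 1)))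
    (h_persist : ∀ t, P t → ∀ p, p ≠ mv t → inp (e (t + 1)) p = inp (e t) p)
    (h_idle : ∀ t, ¬ P t → s (t + 1) = s t ∧ e (t + 1) = e t)
    (h_inf : ∀ t, ∃ u ≥ t, P u) :
    ∃ (x : Run A B disjSat n) (φ : ℕ → ℕ), StrictMono φ ∧ (∀ i, x.s i = s (φ i)) ∧
      (∀ i, x.e i = e (φ i)) ∧ (∀ i, x.mv i = mv (φ i)) ∧ ∀ t, P t → ∃ i, φ i = t := by
  classical
  have hP : {t | P t}.Infinite := Set.infinite_of_forall_exists_gt fun t => by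
    obtain ⟨u, hu, h⟩ := h_inf (t + 1)
    exact ⟨u, h, by omega⟩
  have h_const : ∀ a b, a ≤ b → (∀ t, a ≤ t → t < b → ¬ P t) → s b = s a ∧ e b = e a := by
    intro a b hab
    induction b, hab using Nat.le_induction with
    | base => intro _; exact ⟨rfl, rfl⟩
    | succ b hab ih =>
      intro h
      have h1 := ih fun t h1 h2 => h t h1 (by omega)
      have h2 := h_idle b (h b hab (by omega))
      exact ⟨h2.1.trans h1.1, h2.2.trans h1.2⟩
  have h_mono := Nat.nth_strictMono hP
  have h_next : ∀ i, s (Nat.nth P (i + 1)) = s (Nat.nth P i + 1) ∧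
      e (Nat.nth P (i + 1)) = e (Nat.nth P i + 1) := by
    intro i
    apply h_const _ _ (h_mono (Nat.lt_succ_self i))
    intro t h1 h2 h3
    have := Nat.le_nth_of_lt_nth_succ h2 h3
    omega
  have h_zero : s (Nat.nth P 0) = s 0 := by
    refine (h_const 0 _ (Nat.zero_le _) ?_).1
    intro t _ h2 h3
    rw [Nat.nth_zero] at h2
    exact absurd (Nat.sInf_le (s := {t | P t}) h3) (not_le.2 h2)
  refine ⟨⟨fun i => s (Nat.nth P i), fun i => e (Nat.nth P i), fun i => mv (Nat.nth P i),
    ?_, ?_, ?_⟩, Nat.nth P, h_mono, fun _ => rfl, fun _ => rfl, fun _ => rfl, ?_⟩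
  · rw [h_zero]; exact h_init
  · intro i
    rw [(h_next i).1]
    exact h_step _ (Nat.nth_mem_of_infinite hP i)
  · intro i p hp
    rw [(h_next i).2]
    exact h_persist _ (Nat.nth_mem_of_infinite hP i) p hp
  · intro t ht
    exact ⟨_, Nat.nth_count ht⟩

/-- The moment of a slowed-down clock seen by a process with number `i` when the processes
`0, …, n` take their turns one after the other. -/
def turn (n i T : ℕ) : ℕ := (T + (n - i)) / (n + 1)

theorem turn_succ {n i T : ℕ} (hi : i ≤ n) :
    turn n i (T + 1) = turn n i T + if T % (n + 1) = i then 1 else 0 := by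
  unfold turn
  rw [show T + 1 + (n - i) = (T + (n - i)) + 1 by omega, Nat.succ_div]
  congr 1
  have key : n + 1 ∣ T + (n - i) + 1 ↔ T % (n + 1) = i := by
    have h1 : T + (n - i) + 1 + i = T + (n + 1) := by omega
    have h2 : (T + (n + 1)) % (n + 1) = T % (n + 1) := Nat.add_mod_right _ _
    constructor
    · rintro ⟨k, hk⟩
      rw [← h2, ← h1, hk, Nat.mul_add_mod, Nat.mod_eq_of_lt (by omega)]
    · intro h
      have h3 := Nat.div_add_mod T (n + 1)
      refine ⟨T / (n + 1) + 1, ?_⟩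
      rw [mul_add, mul_one]
      omega
  simp only [key]

theorem turn_eq_or {n i : ℕ} (T : ℕ) :
    turn n i T = T / (n + 1) ∨ turn n i T = T / (n + 1) + 1 := by
  unfold turn
  have h1 : T / (n + 1) ≤ (T + (n - i)) / (n + 1) := Nat.div_le_div_right (by omega)
  have h2 : (T + (n - i)) / (n + 1) ≤ (T + (n + 1)) / (n + 1) := Nat.div_le_div_right (by omega)
  rw [Nat.add_div_right _ (by omega)] at h2
  omega

theorem turn_self {n i : ℕ} (T : ℕ) (hi : T % (n + 1) = i) :
    turn n i T = T / (n + 1) := by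
  unfold turn
  have h3 := Nat.div_add_mod T (n + 1)
  have h4 := Nat.mod_lt T (show 0 < n + 1 by omega)
  rw [Nat.div_eq_of_lt_le]
  · rw [mul_comm]; omega
  · rw [add_mul, one_mul, mul_comm]; omega

/-- The position of a process in the round-robin order. -/
def slot {n : ℕ} : Proc n → ℕ
  | none => n
  | some i => i

theorem slot_le {n : ℕ} (p : Proc n) : slot p ≤ n := by
  cases p with
  | none => exact le_rfl
  | some i => exact i.2.le

theorem slot_injective {n : ℕ} : Function.Injective (slot (n := n)) := by
  intro p q h
  cases p <;> cases q <;> simp only [slot] at h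
  · rfl
  · omega
  · omega
  · rw [Fin.ext h]

theorem exists_slot_eq {n T : ℕ} : ∃ p : Proc n, slot p = T % (n + 1) := by
  have h4 := Nat.mod_lt T (show 0 < n + 1 by omega)
  by_cases h : T % (n + 1) = n
  · exact ⟨none, h.symm⟩
  · exact ⟨some ⟨T % (n + 1), by omega⟩, rfl⟩

/-- A sequence of configurations in which several processes move at the same moment can be
sequentialized to a run, provided that each guard used is witnessed both before and after
the simultaneous move. -/
theorem exists_run_of_simultaneous (m : ℕ → GState QA QB n) (me : ℕ → GInput SA SB n)
    (M : Proc n → ℕ → Prop) (h_init : isInit A B (m 0))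
    (h_idle : ∀ p t, ¬ M p t → view (m (t + 1)) p = view (m t) p ∧
      inp (me (t + 1)) p = inp (me t) p)
    (hA : ∀ t, M none t → ∃ g, ((m t).1, (me t).1, g, (m (t + 1)).1) ∈ A.trans ∧
      ∃ w ≠ none, view (m t) w ∈ g ∧ view (m (t + 1)) w ∈ g)
    (hB : ∀ t k, M (some k) t → ∃ g, ((m t).2 k, (me t).2 k, g, (m (t + 1)).2 k) ∈ B.trans ∧
      ∃ w ≠ some k, view (m t) w ∈ g ∧ view (m (t + 1)) w ∈ g)
    (h_inf : ∃ p, ∀ t, ∃ u ≥ t, M p u) :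
    ∃ x : Run A B disjSat n,
      (∀ p, (∀ t, ∃ u ≥ t, M p u) → ∀ t, ∃ u ≥ t, x.mv u = p) ∧
      ∀ t, ∃ u, ∀ v ≥ u, ∀ p, ∃ t' ≥ t, view (x.s v) p = view (m t') p ∧
        inp (x.e v) p = inp (me t') p := by
  classical
  choose own h_own using fun T => exists_slot_eq (n := n) (T := T)
  let s : ℕ → GState QA QB n := fun T =>
    ((m (turn n n T)).1, fun k => (m (turn n k T)).2 k)
  let e : ℕ → GInput SA SB n := fun T =>
    ((me (turn n n T)).1, fun k => (me (turn n k T)).2 k)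
  have hs : ∀ T p, view (s T) p = view (m (turn n (slot p) T)) p := by
    intro T p; cases p <;> rfl
  have he : ∀ T p, inp (e T) p = inp (me (turn n (slot p) T)) p := by
    intro T p; cases p <;> rfl
  have h_other : ∀ T p, p ≠ own T → turn n (slot p) (T + 1) = turn n (slot p) T := by
    intro T p hp
    rw [turn_succ (slot_le p), if_neg, add_zero]
    rw [← h_own]
    exact fun h => hp (slot_injective h.symm)
  have h_cur : ∀ T, turn n (slot (own T)) T = T / (n + 1) := fun T =>
    turn_self T (h_own T).symm
  have h_nxt : ∀ T, turn n (slot (own T)) (T + 1) = T / (n + 1) + 1 := by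
    intro T
    rw [turn_succ (slot_le _), if_pos (h_own T).symm, h_cur]
  have h_ext : ∀ s s' : GState QA QB n, (∀ p, view s p = view s' p) → s = s' := by
    intro s s' h
    refine Prod.ext (Sum.inl_injective (h none)) (funext fun k => Sum.inr_injective (h (some k)))
  have h_ext' : ∀ s s' : GInput SA SB n, (∀ p, inp s p = inp s' p) → s = s' := by
    intro s s' h
    refine Prod.ext (Sum.inl_injective (h none)) (funext fun k => Sum.inr_injective (h (some k)))
  have h_wit : ∀ T p g, (∃ w ≠ p, view (m (T / (n + 1))) w ∈ g ∧
      view (m (T / (n + 1) + 1)) w ∈ g) → disjSat (others (s T) p) g := by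
    rintro T p g ⟨w, hw, h1, h2⟩
    refine ⟨view (s T) w, ⟨w, hw, rfl⟩, ?_⟩
    rw [hs]
    rcases turn_eq_or (n := n) (i := slot w) T with h | h <;> rw [h] <;> assumption
  have s_init : isInit A B (s 0) := by
    have h0 : ∀ p : Proc n, turn n (slot p) 0 = 0 := fun p => by
      unfold turn
      exact Nat.div_eq_of_lt (by omega)
    have h1 : s 0 = m 0 := h_ext _ _ fun p => by rw [hs, h0]
    exact h1 ▸ h_init
  have s_step : ∀ T, M (own T) (T / (n + 1)) →
      step A B disjSat (s T) (e T) (own T) (s (T + 1)) := by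
    intro T hT
    have h_cur := h_cur T
    have h_nxt := h_nxt T
    have h_other := h_other T
    revert hT h_cur h_nxt h_other
    rcases own T with _ | k <;> intro hT h_cur h_nxt h_other
    · obtain ⟨g, hg, hw⟩ := hA _ hT
      refine ⟨g, (m (T / (n + 1) + 1)).1, ?_,
          h_wit _ _ _ hw, h_ext _ _ fun p => ?_⟩
      · change ((m (turn n (slot (none : Proc n)) T)).1, (me (turn n (slot (none : Proc n)) T)).1, g, _) ∈ _
        rw [h_cur]
        exact hg
      · rcases p with _ | l
        · rw [hs, h_nxt]; rfl
        · rw [hs, h_other _ (by simp), ← hs]; rfl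
    · obtain ⟨g, hg, hw⟩ := hB _ _ hT
      refine ⟨g, (m (T / (n + 1) + 1)).2 k, ?_,
          h_wit _ _ _ hw, h_ext _ _ fun p => ?_⟩
      · change ((m (turn n (slot (some k)) T)).2 k, (me (turn n (slot (some k)) T)).2 k, g, _) ∈ _
        rw [h_cur]
        exact hg
      · by_cases hp : p = some k
        · subst hp
          rw [hs, h_nxt]
          simp [view]
        · rw [hs, h_other _ hp, ← hs]
          rcases p with _ | l
          · rfl
          · have : l ≠ k := fun h => hp (by rw [h])
            simp [view, Function.update_of_ne this]
  have s_persist : ∀ T, M (own T) (T / (n + 1)) → ∀ p, p ≠ own T →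
      inp (e (T + 1)) p = inp (e T) p := by
    intro T _ p hp
    rw [he, he, h_other _ _ hp]
  have s_idle : ∀ T, ¬ M (own T) (T / (n + 1)) → s (T + 1) = s T ∧ e (T + 1) = e T := by
    intro T hT
    have key : ∀ p, view (s (T + 1)) p = view (s T) p ∧ inp (e (T + 1)) p = inp (e T) p := by
      intro p
      rw [hs, he, hs, he]
      by_cases hp : p = own T
      · subst hp
        rw [h_cur, h_nxt]
        exact h_idle _ _ hT
      · rw [h_other _ _ hp]
        exact ⟨rfl, rfl⟩
    exact ⟨h_ext _ _ fun p => (key p).1, h_ext' _ _ fun p => (key p).2⟩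
  have s_inf : ∀ T, ∃ U ≥ T, M (own U) (U / (n + 1)) := by
    intro T
    obtain ⟨p, hp⟩ := h_inf
    obtain ⟨u, hu, hM⟩ := hp T
    have h_div : ((n + 1) * u + slot p) / (n + 1) = u := by
      rw [Nat.mul_add_div (by omega), Nat.div_eq_of_lt (by have := slot_le p; omega), add_zero]
    have h_p : own ((n + 1) * u + slot p) = p := by
      apply slot_injective
      rw [h_own, Nat.mul_add_mod, Nat.mod_eq_of_lt (by have := slot_le p; omega)]
    refine ⟨(n + 1) * u + slot p, ?_, by rw [h_div, h_p]; exact hM⟩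
    have : u ≤ (n + 1) * u := Nat.le_mul_of_pos_left _ (by omega)
    omega
  obtain ⟨x, φ, h_mono, hxs, hxe, hxm, h_hit⟩ := exists_run_of_idling s e own
    (fun T => M (own T) (T / (n + 1))) s_init s_step s_persist s_idle s_inf
  refine ⟨x, ?_, ?_⟩
  · intro p hp t
    obtain ⟨u, hu, hM⟩ := hp (φ t + 1)
    have h_div : ((n + 1) * u + slot p) / (n + 1) = u := by
      rw [Nat.mul_add_div (by omega), Nat.div_eq_of_lt (by have := slot_le p; omega), add_zero]
    have h_p : own ((n + 1) * u + slot p) = p := by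
      apply slot_injective
      rw [h_own, Nat.mul_add_mod, Nat.mod_eq_of_lt (by have := slot_le p; omega)]
    obtain ⟨i, hi⟩ := h_hit ((n + 1) * u + slot p) (by rw [h_div, h_p]; exact hM)
    refine ⟨i, ?_, by rw [hxm, hi, h_p]⟩
    apply h_mono.le_iff_le.1
    rw [hi]
    have : u ≤ (n + 1) * u := Nat.le_mul_of_pos_left _ (by omega)
    omega
  · intro t
    refine ⟨(n + 1) * t, fun v hv p => ⟨turn n (slot p) (φ v), ?_, ?_, ?_⟩⟩
    · have h1 : v ≤ φ v := h_mono.le_apply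
      rcases turn_eq_or (n := n) (i := slot p) (φ v) with h | h <;> rw [h]
      · exact (Nat.le_div_iff_mul_le (by omega)).2 (by rw [mul_comm]; omega)
      · exact Nat.le_succ_of_le
          ((Nat.le_div_iff_mul_le (by omega)).2 (by rw [mul_comm]; omega))
    · rw [hxs, hs]
    · rw [hxe, he]

/-- Time can be coloured with two colours so that finitely many recurring kinds of intervals
all recur within each colour. -/
theorem exists_two_colouring {ι : Type*} [Finite ι] (X : ι → ℕ → ℕ → Prop)
    (hX : ∀ i u, ∃ α β, u ≤ α ∧ α ≤ β ∧ X i α β) :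
    ∃ ω : ℕ → Bool, ∀ i b u, ∃ α β, u ≤ α ∧ α ≤ β ∧ X i α β ∧
      ∀ w, α ≤ w → w ≤ β → ω w = b := by
  classical
  have : ∀ u, ∃ v, u < v ∧ ∀ i, ∃ α β, u ≤ α ∧ α ≤ β ∧ β < v ∧ X i α β := by
    intro u
    choose α β h1 h2 h3 using fun i => hX i u
    cases nonempty_fintype ι
    refine ⟨u + Finset.univ.sup β + 1, by omega, fun i => ⟨α i, β i, h1 i, h2 i, ?_, h3 i⟩⟩
    have := Finset.le_sup (f := β) (Finset.mem_univ i)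
    omega
  choose f hf hfX using this
  let τ : ℕ → ℕ := fun r => f^[r] 0
  have h_succ : ∀ r, τ (r + 1) = f (τ r) := fun r => Function.iterate_succ_apply' f r 0
  have h_mono : StrictMono τ := strictMono_nat_of_lt_succ fun r => by rw [h_succ]; exact hf _
  refine ⟨fun t => decide (∃ r, τ (2 * r) ≤ t ∧ t < τ (2 * r + 1)), fun i b u => ?_⟩
  have h_le : ∀ r, r ≤ τ r := fun r => h_mono.le_apply
  cases b with
  | true =>
    obtain ⟨α, β, h1, h2, h3, h4⟩ := hfX (τ (2 * u)) i
    refine ⟨α, β, by have := h_le (2 * u); omega, h2, h4, fun w hw1 hw2 => ?_⟩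
    rw [decide_eq_true_iff]
    exact ⟨u, by omega, by rw [h_succ]; omega⟩
  | false =>
    obtain ⟨α, β, h1, h2, h3, h4⟩ := hfX (τ (2 * u + 1)) i
    refine ⟨α, β, by have := h_le (2 * u + 1); omega, h2, h4, fun w hw1 hw2 => ?_⟩
    rw [decide_eq_false_iff_not]
    rintro ⟨r, hr1, hr2⟩
    rw [← h_succ] at h3
    have h5 := h_mono.lt_iff_lt.1 (show τ (2 * r) < τ (2 * u + 1 + 1) by omega)
    have h6 := h_mono.lt_iff_lt.1 (show τ (2 * u + 1) < τ (2 * r + 1) by omega)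
    omega


theorem Run.view_succ (x : Run A B disjSat n) {t : ℕ} {p : Proc n} (hp : p ≠ x.mv t) :
    view (x.s (t + 1)) p = view (x.s t) p := by
  have h := x.steps t
  revert h hp
  rcases x.mv t with _ | i <;> intro hp h <;> obtain ⟨g, q, -, -, h⟩ := h <;> rw [h]
  · rcases p with _ | j
    · exact absurd rfl hp
    · rfl
  · rcases p with _ | j
    · rfl
    · have : j ≠ i := fun h => hp (by rw [h])
      simp [view, Function.update_of_ne this]

theorem Run.state_succ (x : Run A B disjSat n) {t : ℕ} {j : Fin n} (hj : x.mv t ≠ some j) :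
    (x.s (t + 1)).2 j = (x.s t).2 j :=
  Sum.inr_injective (x.view_succ hj.symm)

theorem Run.input_succ (x : Run A B disjSat n) {t : ℕ} {j : Fin n} (hj : x.mv t ≠ some j) :
    (x.e (t + 1)).2 j = (x.e t).2 j :=
  Sum.inr_injective (x.persist t _ hj.symm)

theorem Run.enabled_mv (x : Run A B disjSat n) (t : ℕ) :
    enabled A B disjSat (x.s t) (x.e t) (x.mv t) := by
  have h := x.steps t
  revert h
  rcases x.mv t with _ | i <;> rintro ⟨g, q, h1, h2, -⟩ <;> exact ⟨g, q, h1, h2⟩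

theorem Run.const_of_not_mv (x : Run A B disjSat n) {T : ℕ} {p : Proc n}
    (hp : ∀ t ≥ T, x.mv t ≠ p) {t : ℕ} (ht : T ≤ t) :
    view (x.s t) p = view (x.s T) p ∧ inp (x.e t) p = inp (x.e T) p := by
  induction t, ht using Nat.le_induction with
  | base => exact ⟨rfl, rfl⟩
  | succ t ht ih =>
    exact ⟨(x.view_succ (hp t ht).symm).trans ih.1, (x.persist t p (hp t ht).symm).trans ih.2⟩

/-- A process that moves between a moment `u` and a visit of the state `v` has a last move
before that visit, and this move leads to `v`. -/
theorem Run.exists_mv_into (x : Run A B disjSat n) {j : Fin n} {v : QB} {u w : ℕ}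
    (hw : u ≤ w) (hm : x.mv w = some j) {z : ℕ} (hz : w < z) (hv : (x.s z).2 j = v) :
    ∃ y, u ≤ y ∧ x.mv y = some j ∧ (x.s (y + 1)).2 j = v := by
  induction z, hz using Nat.le_induction with
  | base => exact ⟨w, hw, hm, hv⟩
  | succ z hz ih =>
    by_cases h : x.mv z = some j
    · exact ⟨z, by omega, h, hv⟩
    · exact ih ((x.state_succ h).symm.trans hv)

/-- The path of a single `B`-process that imitates the `B`-processes of the run `x`, possibly
switching between them and pausing; `act t` says that it moves at moment `t`. -/
structure Track (x : Run A B disjSat n) where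
  st : ℕ → QB
  ip : ℕ → SB
  act : ℕ → Prop
  init : st 0 = B.init
  idle : ∀ t, ¬ act t → st (t + 1) = st t ∧ ip (t + 1) = ip t
  follow : ∀ t, act t → ∃ j, x.mv t = some j ∧ st t = (x.s t).2 j ∧ ip t = (x.e t).2 j ∧
    st (t + 1) = (x.s (t + 1)).2 j

/-- Imitating one process all the time. -/
def Track.mirror (x : Run A B disjSat n) (j : Fin n) : Track x where
  st t := (x.s t).2 j
  ip t := (x.e t).2 j
  act t := x.mv t = some j
  init := x.isInit0.2 j
  idle _ h := ⟨x.state_succ h, x.input_succ h⟩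
  follow _ h := ⟨j, h, rfl, rfl, rfl⟩

/-- Imitating the process `i` until moment `a` and then, with pauses, the process `j`; `N t` is
the moment from which `j` is imitated next. -/
theorem Track.exists_splice (x : Run A B disjSat n) (i j : Fin n) (a : ℕ) (N : ℕ → ℕ)
    (h_wait : ∀ t ≥ a, N t ≠ t → N (t + 1) = N t)
    (h_go : ∀ t ≥ a, N t = t → N (t + 1) = t + 1 ∨
      (x.mv t = some j ∧ (x.s (N (t + 1))).2 j = (x.s (t + 1)).2 j))
    (h_switch : (x.s (N a)).2 j = (x.s a).2 i)
    (h_arrive : a = 0 ∨ ∃ b, a = b + 1 ∧ x.mv b = some i) :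
    ∃ τ : Track x, (∀ t < a, τ.st t = (x.s t).2 i) ∧
      (∀ t ≥ a, τ.st t = (x.s (N t)).2 j ∧ τ.ip t = (x.e (N t)).2 j ∧
        (τ.act t ↔ N t = t ∧ x.mv t = some j)) := by
  classical
  refine ⟨⟨fun t => if t < a then (x.s t).2 i else (x.s (N t)).2 j,
    fun t => if t < a then (x.e t).2 i else (x.e (N t)).2 j,
    fun t => if t < a then x.mv t = some i else N t = t ∧ x.mv t = some j, ?_, ?_, ?_⟩, ?_, ?_⟩
  · split_ifs with h
    · exact x.isInit0.2 i
    · obtain rfl : a = 0 := by omega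
      rw [h_switch]
      exact x.isInit0.2 i
  · intro t ht
    by_cases h : t < a
    · rw [if_pos h] at ht
      have h' : t + 1 < a := by
        rcases h_arrive with h0 | ⟨b, rfl, hb⟩
        · omega
        · have : t ≠ b := by rintro rfl; exact ht hb
          omega
      rw [if_pos h, if_pos h', if_pos h, if_pos h']
      exact ⟨x.state_succ ht, x.input_succ ht⟩
    · rw [if_neg h] at ht
      have h' : ¬ t + 1 < a := by omega
      rw [if_neg h, if_neg h', if_neg h, if_neg h']
      by_cases hN : N t = t
      · have hm : x.mv t ≠ some j := fun hm => ht ⟨hN, hm⟩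
        rcases h_go t (by omega) hN with h1 | h1
        · rw [h1, hN]
          exact ⟨x.state_succ hm, x.input_succ hm⟩
        · exact absurd h1.1 hm
      · rw [h_wait t (by omega) hN]
        exact ⟨rfl, rfl⟩
  · intro t ht
    by_cases h : t < a
    · rw [if_pos h] at ht
      refine ⟨i, ht, if_pos h, if_pos h, ?_⟩
      by_cases h' : t + 1 < a
      · rw [if_pos h']
      · obtain rfl : a = t + 1 := by omega
        rw [if_neg h', h_switch]
    · rw [if_neg h] at ht
      have h' : ¬ t + 1 < a := by omega
      rw [if_neg h, if_neg h', if_neg h]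
      refine ⟨j, ht.2, by rw [ht.1], by rw [ht.1], ?_⟩
      rcases h_go t (by omega) ht.1 with h1 | h1
      · rw [h1]
      · exact h1.2
  · intro t ht
    exact if_pos ht
  · intro t ht
    have h : ¬ t < a := by omega
    exact ⟨if_neg h, if_neg h, iff_of_eq (if_neg h)⟩

/-- From the moment `T` on, the run `x` has reached its limit behaviour with respect to the
`B`-processes in `R`: local deadlocks have happened, every state visited at all has been
visited, and every state still visited is visited infinitely often. -/
structure Settled (x : Run A B disjSat n) (R : Set (Fin n)) (T : ℕ) : Prop where
  locked : ∀ p, lockedFrom A B disjSat x p → ∀ t ≥ T, ¬ enabled A B disjSat (x.s t) (x.e t) p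
  first : ∀ t, ∀ j ∈ R, ∃ u ≤ T, ∃ i ∈ R, (x.s u).2 i = (x.s t).2 j
  recur : ∀ t ≥ T, ∀ j ∈ R, ∀ u, ∃ w ≥ u, ∃ i ∈ R, (x.s w).2 i = (x.s t).2 j

theorem Settled.not_mv {x : Run A B disjSat n} {R : Set (Fin n)} {T : ℕ} (h : Settled x R T)
    {p : Proc n} (hp : lockedFrom A B disjSat x p) {t : ℕ} (ht : t ≥ T) : x.mv t ≠ p := by
  rintro rfl
  exact h.locked _ hp t ht (x.enabled_mv t)

theorem Settled.state_eq {x : Run A B disjSat n} {R : Set (Fin n)} {T : ℕ} (h : Settled x R T)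
    {j : Fin n} (hj : lockedFrom A B disjSat x (some j)) {t : ℕ} (ht : t ≥ T) :
    (x.s t).2 j = (x.s T).2 j ∧ (x.e t).2 j = (x.e T).2 j :=
  have h1 := x.const_of_not_mv (fun _ hu => h.not_mv hj hu) ht
  ⟨Sum.inr_injective h1.1, Sum.inr_injective h1.2⟩

theorem mv_of_not_locked {x : Run A B disjSat n} (hx : strongFair A B disjSat x) {p : Proc n}
    (hp : ¬ lockedFrom A B disjSat x p) : ∀ t, ∃ u ≥ t, x.mv u = p := by
  refine hx p fun t => ?_
  by_contra! h
  exact hp ⟨t, h⟩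

/-- The track ends in states visited by `R` after `T`, and it either moves infinitely often or
gets stuck as some deadlocked process in `R`. -/
structure Track.Good {x : Run A B disjSat n} (τ : Track x) (R : Set (Fin n)) (T : ℕ) : Prop where
  late : ∀ t ≥ T, ∃ j ∈ R, ∃ u ≥ T, τ.st t = (x.s u).2 j
  fair : (∀ t, ∃ u ≥ t, τ.act u) ∨ ∃ j ∈ R, lockedFrom A B disjSat x (some j) ∧
    ∀ t ≥ T, τ.st t = (x.s T).2 j ∧ τ.ip t = (x.e T).2 j

theorem Settled.good_mirror {x : Run A B disjSat n} {R : Set (Fin n)} {T : ℕ}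
    (h : Settled x R T) (hx : strongFair A B disjSat x) {j : Fin n} (hj : j ∈ R) :
    (Track.mirror x j).Good R T where
  late t ht := ⟨j, hj, t, ht, rfl⟩
  fair := by
    by_cases hl : lockedFrom A B disjSat x (some j)
    · exact Or.inr ⟨j, hj, hl, fun t ht => h.state_eq hl ht⟩
    · exact Or.inl (mv_of_not_locked hx hl)

/-- Between the moments `α` and `β` the process `j` makes a round trip from `v` to `v`. -/
def RoundTrip (x : Run A B disjSat n) (j : Fin n) (v : QB) (α β : ℕ) : Prop :=
  (x.s α).2 j = v ∧ x.mv β = some j ∧ (x.s (β + 1)).2 j = v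

theorem exists_roundTrip (x : Run A B disjSat n) {j : Fin n} {v : QB}
    (hv : ∀ t, ∃ u ≥ t, (x.s u).2 j = v) (hm : ∀ t, ∃ u ≥ t, x.mv u = some j) (u : ℕ) :
    ∃ α β, u ≤ α ∧ α ≤ β ∧ RoundTrip x j v α β := by
  obtain ⟨α, hα, h1⟩ := hv u
  obtain ⟨w, hw, h2⟩ := hm α
  obtain ⟨z, hz, h3⟩ := hv (w + 1)
  obtain ⟨β, hβ, h4, h5⟩ := x.exists_mv_into hw h2 hz h3
  exact ⟨α, β, hα, hβ, h1, h4, h5⟩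

/-- A track visiting the state `v`: it is present in `v` as long as the processes in `R` can be
before `T`; afterwards it stays there if a process of `R` is deadlocked in `v`, or if `v` recurs
and the colour of the moment differs from `b`. -/
structure Track.Covers {x : Run A B disjSat n} (τ : Track x) (R : Set (Fin n)) (T : ℕ)
    (ω : ℕ → Bool) (v : QB) (b : Bool) : Prop extends τ.Good R T where
  early : ∀ t < T, ∀ j ∈ R, x.mv t ≠ some j → (x.s t).2 j = v → τ.st t = v ∧ ¬ τ.act t
  stuck : (∃ j ∈ R, lockedFrom A B disjSat x (some j) ∧ (x.s T).2 j = v) →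
    ∃ j ∈ R, lockedFrom A B disjSat x (some j) ∧ (x.s T).2 j = v ∧
      ∀ t ≥ T, τ.st t = v ∧ τ.ip t = (x.e T).2 j ∧ ¬ τ.act t
  cyclic : (∃ t ≥ T, ∃ j ∈ R, (x.s t).2 j = v) →
    (¬ ∃ j ∈ R, lockedFrom A B disjSat x (some j) ∧ (x.s T).2 j = v) →
    ∀ t ≥ T, ω t ≠ b → τ.st t = v ∧ ¬ τ.act t

theorem exists_least_visit (x : Run A B disjSat n) (R : Set (Fin n)) {v : QB} {t : ℕ}
    {j : Fin n} (hj : j ∈ R) (hv : (x.s t).2 j = v) :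
    ∃ a, ∃ i ∈ R, (x.s a).2 i = v ∧ (a = 0 ∨ ∃ b, a = b + 1 ∧ x.mv b = some i) ∧
      ∀ u, ∀ k ∈ R, (x.s u).2 k = v → a ≤ u := by
  classical
  have hex : ∃ t, ∃ j ∈ R, (x.s t).2 j = v := ⟨t, j, hj, hv⟩
  obtain ⟨i, hi, hiv⟩ := Nat.find_spec hex
  refine ⟨Nat.find hex, i, hi, hiv, ?_, fun u k hk h => Nat.find_min' hex ⟨k, hk, h⟩⟩
  rcases h : Nat.find hex with _ | b
  · exact Or.inl rfl
  · refine Or.inr ⟨b, rfl, ?_⟩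
    by_contra hb
    rw [h, x.state_succ hb] at hiv
    exact Nat.find_min hex (m := b) (by omega) ⟨i, hi, hiv⟩

theorem Settled.exists_covers_of_locked {x : Run A B disjSat n} {R : Set (Fin n)} {T : ℕ}
    (h : Settled x R T) (ω : ℕ → Bool) (b : Bool) {j : Fin n} (hj : j ∈ R)
    (hl : lockedFrom A B disjSat x (some j)) :
    ∃ τ : Track x, τ.Covers R T ω ((x.s T).2 j) b := by
  obtain ⟨a, i, hi, hiv, ha, h_least⟩ := exists_least_visit x R hj rfl
  have haT : a ≤ T := h_least T j hj rfl
  have hN : ∀ t, (x.s (max t T)).2 j = (x.s T).2 j ∧ (x.e (max t T)).2 j = (x.e T).2 j :=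
    fun t => h.state_eq hl (le_max_right t T)
  obtain ⟨τ, -, h2⟩ := Track.exists_splice x i j a (fun t => max t T)
    (fun t _ ht => by omega) (fun t _ ht => by omega)
    ((hN a).1.trans hiv.symm) ha
  have h_st : ∀ t ≥ a, τ.st t = (x.s T).2 j := fun t ht => (h2 t ht).1.trans (hN t).1
  have h_ip : ∀ t ≥ a, τ.ip t = (x.e T).2 j := fun t ht => (h2 t ht).2.1.trans (hN t).2
  have h_act : ∀ t ≥ a, ¬ τ.act t := by
    intro t ht hact
    obtain ⟨h3, h4⟩ := (h2 t ht).2.2.1 hact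
    exact h.not_mv hl (show t ≥ T by omega) h4
  exact ⟨τ, {
    late := fun t ht => ⟨j, hj, T, le_rfl, h_st t (haT.trans ht)⟩
    fair := Or.inr ⟨j, hj, hl, fun t ht => ⟨h_st t (haT.trans ht), h_ip t (haT.trans ht)⟩⟩
    early := fun t _ k hk _ hv => ⟨h_st t (h_least t k hk hv), h_act t (h_least t k hk hv)⟩
    stuck := fun _ => ⟨j, hj, hl, rfl, fun t ht =>
      ⟨h_st t (haT.trans ht), h_ip t (haT.trans ht), h_act t (haT.trans ht)⟩⟩
    cyclic := fun _ hn => absurd ⟨j, hj, hl, rfl⟩ hn }⟩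

theorem Settled.exists_covers_of_transient {x : Run A B disjSat n} {R : Set (Fin n)} {T : ℕ}
    (h : Settled x R T) (hx : strongFair A B disjSat x) (ω : ℕ → Bool) (b : Bool) {v : QB}
    (hv : ∃ t, ∃ j ∈ R, (x.s t).2 j = v) (hT : ∀ t ≥ T, ∀ j ∈ R, (x.s t).2 j ≠ v) :
    ∃ τ : Track x, τ.Covers R T ω v b := by
  classical
  obtain ⟨t0, j0, hj0, hv0⟩ := hv
  obtain ⟨a, i, hi, hiv, ha, h_least⟩ := exists_least_visit x R hj0 hv0
  have h_lt : ∀ t, ∀ j ∈ R, (x.s t).2 j = v → t < T := fun t j hj h => by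
    by_contra ht
    exact hT t (by omega) j hj h
  obtain ⟨l, ⟨j, hj, hjv⟩, h_last⟩ : ∃ l, (∃ j ∈ R, (x.s l).2 j = v) ∧
      ∀ t, (∃ j ∈ R, (x.s t).2 j = v) → t ≤ l := by
    refine ⟨Nat.findGreatest (fun l => ∃ j ∈ R, (x.s l).2 j = v) T,
      Nat.findGreatest_spec (P := fun l => ∃ j ∈ R, (x.s l).2 j = v)
        (h_lt t0 j0 hj0 hv0).le ⟨j0, hj0, hv0⟩, ?_⟩
    rintro t ⟨k, hk, hkv⟩
    exact Nat.le_findGreatest (h_lt t k hk hkv).le ⟨k, hk, hkv⟩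
  have hal : a ≤ l := h_least l j hj hjv
  have hlT : l < T := h_lt l j hj hjv
  have h_leave : ∀ k ∈ R, (x.s l).2 k = v → x.mv l = some k := by
    intro k hk hkv
    by_contra hm
    have := h_last (l + 1) ⟨k, hk, (x.state_succ hm).trans hkv⟩
    omega
  obtain ⟨τ, -, h2⟩ := Track.exists_splice x i j a (fun t => max t l)
    (fun t _ ht => by omega) (fun t _ ht => by omega)
    (by rw [max_eq_right hal]; exact hjv.trans hiv.symm) ha
  have h_late : ∀ t ≥ T, τ.st t = (x.s t).2 j ∧ τ.ip t = (x.e t).2 j ∧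
      (τ.act t ↔ x.mv t = some j) := by
    intro t ht
    have h3 := h2 t (by omega)
    rw [max_eq_left (by omega)] at h3
    simpa using h3
  refine ⟨τ, ⟨⟨fun t ht => ⟨j, hj, t, ht, (h_late t ht).1⟩, ?_⟩, ?_, ?_, ?_⟩⟩
  · by_cases hl : lockedFrom A B disjSat x (some j)
    · refine Or.inr ⟨j, hj, hl, fun t ht => ?_⟩
      have h3 := h.state_eq hl ht
      exact ⟨(h_late t ht).1.trans h3.1, (h_late t ht).2.1.trans h3.2⟩
    · refine Or.inl fun t => ?_
      obtain ⟨u, hu, hm⟩ := mv_of_not_locked hx hl (max t T)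
      exact ⟨u, (le_max_left _ _).trans hu, (h_late u ((le_max_right _ _).trans hu)).2.2.2 hm⟩
  · intro t _ k hk hm hkv
    have h3 : t ≤ l := h_last t ⟨k, hk, hkv⟩
    have h4 : t ≠ l := by
      rintro rfl
      exact hm (h_leave k hk hkv)
    have h5 := h2 t (h_least t k hk hkv)
    rw [max_eq_right h3] at h5
    exact ⟨h5.1.trans hjv, fun hact => h4 (h5.2.2.1 hact).1.symm⟩
  · rintro ⟨k, hk, -, hkv⟩
    exact absurd hkv (hT T le_rfl k hk)
  · rintro ⟨t, ht, k, hk, hkv⟩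
    exact absurd hkv (hT t ht k hk)

theorem Settled.exists_covers_of_cyclic {x : Run A B disjSat n} {R : Set (Fin n)} {T : ℕ}
    (h : Settled x R T) (ω : ℕ → Bool) (b : Bool) {v : QB} {j : Fin n} (hj : j ∈ R)
    (hv : ∃ t ≥ T, (x.s t).2 j = v)
    (hω : ∀ u, ∃ α β, u ≤ α ∧ α ≤ β ∧ RoundTrip x j v α β ∧ ∀ w, α ≤ w → w ≤ β → ω w = b)
    (hn : ¬ ∃ j ∈ R, lockedFrom A B disjSat x (some j) ∧ (x.s T).2 j = v) :
    ∃ τ : Track x, τ.Covers R T ω v b := by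
  classical
  obtain ⟨t0, ht0, hv0⟩ := hv
  obtain ⟨a, i, hi, hiv, ha, h_least⟩ := exists_least_visit x R hj hv0
  have haT : a ≤ T := by
    obtain ⟨u, hu, k, hk, hkv⟩ := h.first t0 j hj
    exact (h_least u k hk (hkv.trans hv0)).trans hu
  let act : ℕ → Prop := fun t => ∃ α β, T ≤ α ∧ α ≤ t ∧ t ≤ β ∧ RoundTrip x j v α β ∧
    ∀ w, α ≤ w → w ≤ β → ω w = b
  have h_ex : ∀ t, ∃ u, t ≤ u ∧ act u := by
    intro t
    obtain ⟨α, β, h1, h2, h3, h4⟩ := hω (max t T)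
    exact ⟨α, (le_max_left _ _).trans h1, α, β, (le_max_right _ _).trans h1, le_rfl, h2, h3, h4⟩
  have h_enter : ∀ t, act (t + 1) → ¬ act t → (x.s (t + 1)).2 j = v := by
    rintro t ⟨α, β, h1, h2, h3, h4, h5⟩ hna
    rcases h2.eq_or_lt with rfl | h6
    · exact h4.1
    · exact absurd ⟨α, β, h1, by omega, by omega, h4, h5⟩ hna
  have h_exit : ∀ t, act t → ¬ act (t + 1) → x.mv t = some j ∧ (x.s (t + 1)).2 j = v := by
    rintro t ⟨α, β, h1, h2, h3, h4, h5⟩ hna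
    rcases h3.eq_or_lt with rfl | h6
    · exact h4.2
    · exact absurd ⟨α, β, h1, by omega, by omega, h4, h5⟩ hna
  let N : ℕ → ℕ := fun t => Nat.find (h_ex t)
  have hN_le : ∀ t, t ≤ N t := fun t => (Nat.find_spec (h_ex t)).1
  have hN_act : ∀ t, act (N t) := fun t => (Nat.find_spec (h_ex t)).2
  have hN_min : ∀ t u, t ≤ u → act u → N t ≤ u := fun t u h1 h2 => Nat.find_min' _ ⟨h1, h2⟩
  have hN_self : ∀ t, act t → N t = t := fun t ht => le_antisymm (hN_min t t le_rfl ht) (hN_le t)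
  have hN_state : ∀ t, ¬ act t → (x.s (N t)).2 j = v := by
    intro t ht
    have h1 : N t ≠ t := fun h => ht (h ▸ hN_act t)
    have h2 := hN_le t
    obtain ⟨m, hm⟩ : ∃ m, N t = m + 1 := ⟨N t - 1, by omega⟩
    have h3 := hN_act t
    rw [hm] at h3 ⊢
    refine h_enter m h3 fun h4 => ?_
    have := hN_min t m (by omega) h4
    omega
  have h_not_act : ∀ t < T, ¬ act t := by
    rintro t ht ⟨α, β, h1, h2, -⟩
    omega
  have h_wait : ∀ t ≥ a, N t ≠ t → N (t + 1) = N t := by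
    intro t _ ht
    have h1 := hN_le t
    exact le_antisymm (hN_min _ _ (by omega) (hN_act t))
      (hN_min _ _ (Nat.le_of_succ_le (hN_le (t + 1))) (hN_act (t + 1)))
  have h_go : ∀ t ≥ a, N t = t → N (t + 1) = t + 1 ∨
      (x.mv t = some j ∧ (x.s (N (t + 1))).2 j = (x.s (t + 1)).2 j) := by
    intro t _ ht
    by_cases h1 : act (t + 1)
    · exact Or.inl (hN_self _ h1)
    · obtain ⟨h2, h3⟩ := h_exit t (ht ▸ hN_act t) h1
      exact Or.inr ⟨h2, (hN_state _ h1).trans h3.symm⟩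
  have h_switch : (x.s (N a)).2 j = (x.s a).2 i := by
    rw [hiv]
    by_cases h1 : act a
    · rw [hN_self _ h1]
      obtain ⟨α, β, h2, h3, -, h4, -⟩ := h1
      obtain rfl : α = a := by omega
      exact h4.1
    · exact hN_state _ h1
  obtain ⟨τ, -, h2⟩ := Track.exists_splice x i j a N h_wait h_go h_switch ha
  have h_rest : ∀ t ≥ a, ¬ act t → τ.st t = v ∧ ¬ τ.act t := by
    intro t ht h1
    refine ⟨(h2 t ht).1.trans (hN_state t h1), fun h3 => h1 ?_⟩
    have := ((h2 t ht).2.2.1 h3).1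
    exact this ▸ hN_act t
  refine ⟨τ, ⟨⟨fun t ht => ⟨j, hj, N t, ht.le.trans (hN_le t), (h2 t (by omega)).1⟩, ?_⟩,
    ?_, ?_, ?_⟩⟩
  · refine Or.inl fun t => ?_
    obtain ⟨α, β, h3, h4, h5, h6⟩ := hω (max t T)
    have h7 : max t T ≤ β := h3.trans h4
    refine ⟨β, (le_max_left _ _).trans h7, (h2 β ?_).2.2.2 ⟨hN_self β ?_, h5.2.1⟩⟩
    · exact (haT.trans (le_max_right t T)).trans h7
    · exact ⟨α, β, (le_max_right _ _).trans h3, h4, le_rfl, h5, h6⟩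
  · intro t ht k hk _ hkv
    exact h_rest t (h_least t k hk hkv) (h_not_act t ht)
  · exact fun h1 => absurd h1 hn
  · intro _ _ t ht hb
    refine h_rest t (by omega) ?_
    rintro ⟨α, β, -, h3, h4, -, h5⟩
    exact hb (h5 t h3 h4)

/-- Every state visited by `R` has a covering track of each colour. -/
theorem Settled.exists_colouring_covers [Finite QB] {x : Run A B disjSat n} {R : Set (Fin n)}
    {T : ℕ} (h : Settled x R T) (hx : strongFair A B disjSat x) :
    ∃ ω : ℕ → Bool, ∀ v b, (∃ t, ∃ j ∈ R, (x.s t).2 j = v) →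
      ∃ τ : Track x, τ.Covers R T ω v b := by
  obtain ⟨ω, hω⟩ := exists_two_colouring
    (ι := {z : Fin n × QB // (∀ t, ∃ u ≥ t, (x.s u).2 z.1 = z.2) ∧
      ∀ t, ∃ u ≥ t, x.mv u = some z.1})
    (fun z => RoundTrip x z.1.1 z.1.2) (fun z => exists_roundTrip x z.2.1 z.2.2)
  refine ⟨ω, fun v b hv => ?_⟩
  by_cases h1 : ∃ j ∈ R, lockedFrom A B disjSat x (some j) ∧ (x.s T).2 j = v
  · obtain ⟨j, hj, hl, rfl⟩ := h1
    exact h.exists_covers_of_locked ω b hj hl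
  by_cases h2 : ∃ t ≥ T, ∃ j ∈ R, (x.s t).2 j = v
  · obtain ⟨t, ht, j, hj, rfl⟩ := h2
    obtain ⟨i, hi, h_inf⟩ : ∃ i ∈ R, ∀ u, ∃ w ≥ u, (x.s w).2 i = (x.s t).2 j := by
      by_contra! hc
      choose f hf using fun i : R => hc i i.2
      obtain ⟨M, hM⟩ := Finite.exists_le f
      obtain ⟨w, hw, i, hi, hiv⟩ := h.recur t ht j hj M
      exact hf ⟨i, hi⟩ w ((hM ⟨i, hi⟩).trans hw) hiv
    have hl : ¬ lockedFrom A B disjSat x (some i) := by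
      intro hl
      obtain ⟨w, hw, hiv⟩ := h_inf T
      exact h1 ⟨i, hi, hl, (h.state_eq hl hw).1.symm.trans hiv⟩
    exact h.exists_covers_of_cyclic ω b hi (h_inf T)
      (hω ⟨(i, _), h_inf, mv_of_not_locked hx hl⟩ b) h1
  · push Not at h2
    exact h.exists_covers_of_transient hx ω b hv h2


theorem exists_settled [Finite QB] (x : Run A B disjSat n) : ∃ T, ∀ R, Settled x R T := by
  classical
  have h_locked : ∀ p : Proc n, ∃ t0, lockedFrom A B disjSat x p → ∀ t ≥ t0,
      ¬ enabled A B disjSat (x.s t) (x.e t) p := by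
    intro p
    by_cases hp : lockedFrom A B disjSat x p
    · obtain ⟨t0, h⟩ := hp
      exact ⟨t0, fun _ => h⟩
    · exact ⟨0, fun h => absurd h hp⟩
  have h_first : ∀ z : Set (Fin n) × QB, ∃ u0, (∃ t, ∃ j ∈ z.1, (x.s t).2 j = z.2) →
      ∃ u ≤ u0, ∃ i ∈ z.1, (x.s u).2 i = z.2 := by
    intro z
    by_cases hz : ∃ t, ∃ j ∈ z.1, (x.s t).2 j = z.2
    · obtain ⟨t, h⟩ := hz
      exact ⟨t, fun _ => ⟨t, le_rfl, h⟩⟩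
    · exact ⟨0, fun h => absurd h hz⟩
  have h_recur : ∀ z : Set (Fin n) × QB, ∃ u0, ∀ t ≥ u0, (∃ j ∈ z.1, (x.s t).2 j = z.2) →
      ∀ u, ∃ w ≥ u, ∃ i ∈ z.1, (x.s w).2 i = z.2 := by
    intro z
    by_cases hz : ∀ u, ∃ w ≥ u, ∃ i ∈ z.1, (x.s w).2 i = z.2
    · exact ⟨0, fun _ _ _ => hz⟩
    · push Not at hz
      obtain ⟨u, hu⟩ := hz
      exact ⟨u, fun t ht ⟨j, hj, h⟩ => absurd h (hu t ht j hj)⟩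
  choose f hf using h_locked
  choose f' hf' using h_first
  choose f'' hf'' using h_recur
  obtain ⟨M, hM⟩ := Finite.exists_le f
  obtain ⟨M', hM'⟩ := Finite.exists_le f'
  obtain ⟨M'', hM''⟩ := Finite.exists_le f''
  refine ⟨M + M' + M'', fun R => ⟨?_, ?_, ?_⟩⟩
  · intro p hp t ht
    exact hf p hp t (by have := hM p; omega)
  · intro t j hj
    obtain ⟨u, hu, h⟩ := hf' (R, (x.s t).2 j) ⟨t, j, hj, rfl⟩
    exact ⟨u, by have := hM' (R, (x.s t).2 j); omega, h⟩
  · intro t ht j hj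
    exact hf'' (R, (x.s t).2 j) t (by have := hM'' (R, (x.s t).2 j); omega) ⟨j, hj, rfl⟩

theorem Run.exists_mv_infinitely_often (x : Run A B disjSat n) :
    ∃ p, ∀ t, ∃ u ≥ t, x.mv u = p := by
  by_contra! h
  choose f hf using h
  obtain ⟨M, hM⟩ := Finite.exists_le f
  exact hf (x.mv M) M (hM _) rfl

theorem Settled.not_mem_of_trans {x : Run A B disjSat n} {R : Set (Fin n)} {T : ℕ}
    (h : Settled x R T) {i : Fin n} (hl : lockedFrom A B disjSat x (some i)) {g : Set (QA ⊕ QB)}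
    {q : QB} (hg : ((x.s T).2 i, (x.e T).2 i, g, q) ∈ B.trans) {t : ℕ} (ht : t ≥ T)
    {p : Proc n} (hp : p ≠ some i) : view (x.s t) p ∉ g := by
  intro hv
  obtain ⟨h1, h2⟩ := h.state_eq hl ht
  refine h.locked _ hl t ht ⟨g, q, ?_, view (x.s t) p, ⟨p, hp, rfl⟩, hv⟩
  rw [h1, h2]
  exact hg

/-- There are tracks indexed by the states of `B`, a set `G` of guards, and one further index,
that witness all guards in `G` used in `x`. The processes outside `R`, each of which is assigned
a guard of its own by `γ`, are imitated exactly. -/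
theorem Settled.exists_tracks [Finite QB] {x : Run A B disjSat n} {R : Set (Fin n)} {T : ℕ}
    (h : Settled x R T) (hx : strongFair A B disjSat x) (hR : R.Nonempty)
    (G : Set (Set (QA ⊕ QB))) (γ : Fin n → Set (QA ⊕ QB)) (hγ : ∀ s ∉ R, γ s ∈ G)
    (hγ_inj : ∀ s ∉ R, ∀ s' ∉ R, γ s = γ s' → s = s')
    (hγ_priv : ∀ s ∉ R, ∀ t ≥ T, ∀ j ∈ R, Sum.inr ((x.s t).2 j) ∉ γ s) :
    ∃ (τ : QB ⊕ G ⊕ Unit → Track x) (o : QB ⊕ G ⊕ Unit → Option (Fin n)),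
      (∀ k, o k = none → (τ k).Good R T) ∧
      (∀ k s, o k = some s → s ∉ R ∧ τ k = Track.mirror x s) ∧
      (∀ k k' s, o k = some s → o k' = some s → k = k') ∧
      (∀ s ∉ R, ∃ k, o k = some s) ∧
      (∀ g ∈ G, ∀ t, ∀ j ∈ R, x.mv t ≠ some j → Sum.inr ((x.s t).2 j) ∈ g →
        ∃ k, ¬ (τ k).act t ∧ Sum.inr ((τ k).st t) ∈ g) ∧
      (∀ j ∈ R, lockedFrom A B disjSat x (some j) → ∃ k, o k = none ∧ ¬ ∀ t, ∃ u ≥ t, (τ k).act u) ∧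
      ((∃ j ∈ R, ∀ t, ∃ u ≥ t, x.mv u = some j) → ∃ k, ∀ t, ∃ u ≥ t, (τ k).act u) := by
  classical
  obtain ⟨r, hr, h_mv⟩ : ∃ r ∈ R, (∃ j ∈ R, ∀ t, ∃ u ≥ t, x.mv u = some j) →
      ∀ t, ∃ u ≥ t, x.mv u = some r := by
    by_cases hj : ∃ j ∈ R, ∀ t, ∃ u ≥ t, x.mv u = some j
    · obtain ⟨j, hj, h1⟩ := hj
      exact ⟨j, hj, fun _ => h1⟩
    · exact ⟨hR.some, hR.some_mem, fun h => absurd h hj⟩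
  obtain ⟨ω, hω⟩ := h.exists_colouring_covers hx
  let Rec : Set (QA ⊕ QB) → QB → Prop := fun g v => Sum.inr v ∈ g ∧
    (∃ t ≥ T, ∃ j ∈ R, (x.s t).2 j = v) ∧
    ¬ ∃ j ∈ R, lockedFrom A B disjSat x (some j) ∧ (x.s T).2 j = v
  have hF : ∀ v, ∃ τ : Track x, τ.Good R T ∧
      ((∃ t, ∃ j ∈ R, (x.s t).2 j = v) → τ.Covers R T ω v false) := by
    intro v
    by_cases hv : ∃ t, ∃ j ∈ R, (x.s t).2 j = v
    · obtain ⟨τ, hτ⟩ := hω v false hv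
      exact ⟨τ, hτ.toGood, fun _ => hτ⟩
    · exact ⟨_, h.good_mirror hx hr, fun h => absurd h hv⟩
  have hE : ∀ g : G, ∃ (τ : Track x) (o : Option (Fin n)), (o = none → τ.Good R T) ∧
      (∀ s, o = some s → s ∉ R ∧ γ s = g ∧ τ = Track.mirror x s) ∧
      (∀ s ∉ R, γ s = g → o = some s) ∧
      ((∀ s ∉ R, γ s ≠ g) → (∃ v, Rec g v) → ∃ v, Rec g v ∧ τ.Covers R T ω v true) := by
    intro g
    by_cases hs : ∃ s, s ∉ R ∧ γ s = g
    · obtain ⟨s, hs, hsg⟩ := hs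
      refine ⟨Track.mirror x s, some s, by simp, ?_, ?_, fun h1 => absurd hsg (h1 s hs)⟩
      · rintro s' h1
        obtain rfl := Option.some_injective _ h1
        exact ⟨hs, hsg, rfl⟩
      · intro s' hs' h1
        rw [hγ_inj s hs s' hs' (hsg.trans h1.symm)]
    · by_cases hv : ∃ v, Rec g v
      · obtain ⟨v, h1⟩ := hv
        obtain ⟨t, -, j, hj, hjv⟩ := h1.2.1
        obtain ⟨τ, hτ⟩ := hω v true ⟨t, j, hj, hjv⟩
        exact ⟨τ, none, fun _ => hτ.toGood, by simp, fun s h2 h3 => absurd ⟨s, h2, h3⟩ hs,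
          fun _ _ => ⟨v, h1, hτ⟩⟩
      · exact ⟨_, none, fun _ => h.good_mirror hx hr, by simp,
          fun s h2 h3 => absurd ⟨s, h2, h3⟩ hs, fun _ h1 => absurd h1 hv⟩
  choose F hF_good hF using hF
  choose E o hE_good hE_some hE_own hE using hE
  refine ⟨Sum.elim F (Sum.elim E fun _ => Track.mirror x r),
    Sum.elim (fun _ => none) (Sum.elim o fun _ => none), ?_, ?_, ?_, ?_, ?_, ?_, ?_⟩
  · rintro (v | g | _) hk
    · exact hF_good v
    · exact hE_good g hk
    · exact h.good_mirror hx hr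
  · rintro (v | g | _) s hk
    · simp at hk
    · exact ⟨(hE_some g s hk).1, (hE_some g s hk).2.2⟩
    · simp at hk
  · rintro (v | g | _) (v' | g' | _) s hk hk'
    all_goals first
      | (simp at hk; done)
      | (simp at hk'; done)
      | skip
    have h1 := (hE_some g s hk).2.1
    have h2 := (hE_some g' s hk').2.1
    rw [Subtype.ext (h1.symm.trans h2)]
  · intro s hs
    exact ⟨Sum.inr (Sum.inl ⟨γ s, hγ s hs⟩), hE_own ⟨γ s, hγ s hs⟩ s hs rfl⟩
  · intro g hg t j hj hm hjg
    rcases lt_or_ge t T with ht | ht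
    · have h1 := (hF _ ⟨t, j, hj, rfl⟩).early t ht j hj hm rfl
      refine ⟨Sum.inl ((x.s t).2 j), h1.2, ?_⟩
      simp only [Sum.elim_inl, h1.1]
      exact hjg
    by_cases hl : ∃ v, Sum.inr v ∈ g ∧ ∃ j ∈ R, lockedFrom A B disjSat x (some j) ∧ (x.s T).2 j = v
    · obtain ⟨v, hv, hlv⟩ := hl
      obtain ⟨i, hi, -, hiv⟩ := id hlv
      obtain ⟨_, -, -, -, h1⟩ := (hF v ⟨T, i, hi, hiv⟩).stuck hlv
      refine ⟨Sum.inl v, (h1 t ht).2.2, ?_⟩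
      simp only [Sum.elim_inl, (h1 t ht).1]
      exact hv
    · have h_rec : Rec g ((x.s t).2 j) := ⟨hjg, ⟨t, ht, j, hj, rfl⟩, fun h1 => hl ⟨_, hjg, h1⟩⟩
      have h_free : ∀ s ∉ R, γ s ≠ g := by
        rintro s hs rfl
        exact hγ_priv s hs t ht j hj hjg
      obtain ⟨v, hv, hcov⟩ := hE ⟨g, hg⟩ h_free ⟨_, h_rec⟩
      by_cases hb : ω t = true
      · obtain ⟨u, -, i, hi, hiv⟩ := hv.2.1
        have h1 := (hF v ⟨u, i, hi, hiv⟩).cyclic hv.2.1 hv.2.2 t ht (by simp [hb])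
        refine ⟨Sum.inl v, h1.2, ?_⟩
        simp only [Sum.elim_inl, h1.1]
        exact hv.1
      · have h1 := hcov.cyclic hv.2.1 hv.2.2 t ht hb
        refine ⟨Sum.inr (Sum.inl ⟨g, hg⟩), h1.2, ?_⟩
        simp only [Sum.elim_inl, Sum.elim_inr, h1.1]
        exact hv.1
  · intro j hj hl
    refine ⟨Sum.inl ((x.s T).2 j), rfl, fun h1 => ?_⟩
    obtain ⟨_, -, -, -, h2⟩ := (hF _ ⟨T, j, hj, rfl⟩).stuck ⟨j, hj, hl, rfl⟩
    obtain ⟨u, hu, h3⟩ := h1 T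
    exact (h2 u hu).2.2 h3
  · intro hj
    exact ⟨Sum.inr (Sum.inr ()), h_mv hj⟩

/-- The `B`-processes that are deadlocked from `T` on but would be enabled by a second process
in the same local state. -/
def SelfEnabled (x : Run A B disjSat n) (T : ℕ) : Set (Fin n) :=
  {i | lockedFrom A B disjSat x (some i) ∧
    ∃ g q, ((x.s T).2 i, (x.e T).2 i, g, q) ∈ B.trans ∧ Sum.inr ((x.s T).2 i) ∈ g}

theorem Settled.exists_private_guards {x : Run A B disjSat n} {R : Set (Fin n)} {T : ℕ}
    (h : Settled x R T) :
    ∃ γ : Fin n → Set (QA ⊕ QB), ∀ s ∈ SelfEnabled x T, γ s ∈ ntGuards A ∪ ntGuards B ∧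
      Sum.inr ((x.s T).2 s) ∈ γ s ∧ ∀ t ≥ T, ∀ p ≠ some s, view (x.s t) p ∉ γ s := by
  have key : ∀ s, ∃ g, s ∈ SelfEnabled x T → g ∈ ntGuards A ∪ ntGuards B ∧
      Sum.inr ((x.s T).2 s) ∈ g ∧ ∀ t ≥ T, ∀ p ≠ some s, view (x.s t) p ∉ g := by
    intro s
    by_cases hs : s ∈ SelfEnabled x T
    · obtain ⟨hl, g, q, hg, hsg⟩ := hs
      have h1 : ∀ t ≥ T, ∀ p ≠ some s, view (x.s t) p ∉ g :=
        fun t ht p hp => h.not_mem_of_trans hl hg ht hp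
      refine ⟨g, fun _ => ⟨Or.inr ⟨⟨_, _, _, hg⟩, ?_, ?_⟩, hsg, h1⟩⟩
      · rintro rfl
        exact h1 T le_rfl none (by simp) (Set.mem_univ _)
      · rintro rfl
        exact hsg
    · exact ⟨∅, fun h => absurd h hs⟩
  choose γ hγ using key
  exact ⟨γ, hγ⟩

/-- Simulation of `x` by one `A`-process and `c` tracks. -/
theorem exists_run_of_tracks {c : ℕ} (hc : 0 < c) (x : Run A B disjSat n) (τ : Fin c → Track x)
    (h_wit : ∀ g ∈ ntGuards A ∪ ntGuards B, ∀ t j, x.mv t ≠ some j → Sum.inr ((x.s t).2 j) ∈ g →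
      ∃ k, ¬ (τ k).act t ∧ Sum.inr ((τ k).st t) ∈ g)
    (h_inf : (∃ j, ∀ t, ∃ u ≥ t, x.mv u = some j) → ∃ k, ∀ t, ∃ u ≥ t, (τ k).act u) :
    ∃ y : Run A B disjSat c,
      ((∀ t, ∃ u ≥ t, x.mv u = none) → ∀ t, ∃ u ≥ t, y.mv u = none) ∧
      (∀ k, (∀ t, ∃ u ≥ t, (τ k).act u) → ∀ t, ∃ u ≥ t, y.mv u = some k) ∧
      ∀ t, ∃ u, ∀ v ≥ u, (∃ t' ≥ t, (y.s v).1 = (x.s t').1 ∧ (y.e v).1 = (x.e t').1) ∧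
        ∀ k, ∃ t' ≥ t, (y.s v).2 k = (τ k).st t' ∧ (y.e v).2 k = (τ k).ip t' := by
  let m : ℕ → GState QA QB c := fun t => ((x.s t).1, fun k => (τ k).st t)
  let me : ℕ → GInput SA SB c := fun t => ((x.e t).1, fun k => (τ k).ip t)
  let M : Proc c → ℕ → Prop := fun p t => p.elim (x.mv t = none) fun k => (τ k).act t
  have h_wit' : ∀ g ∈ guardsOf A ∪ guardsOf B, g ≠ Set.univ → ∀ t j, x.mv t ≠ some j →
      Sum.inr ((x.s t).2 j) ∈ g →
      ∃ k, ¬ (τ k).act t ∧ view (m t) (some k) ∈ g ∧ view (m (t + 1)) (some k) ∈ g := by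
    intro g hg hu t j hj hjg
    have hne : g ≠ ∅ := fun h => (h ▸ hjg : Sum.inr ((x.s t).2 j) ∈ (∅ : Set (QA ⊕ QB)))
    obtain ⟨k, hk, hkg⟩ :=
      h_wit g (hg.imp (fun h => ⟨h, hu, hne⟩) fun h => ⟨h, hu, hne⟩) t j hj hjg
    refine ⟨k, hk, hkg, ?_⟩
    simp only [m, view, ((τ k).idle t hk).1]
    exact hkg
  obtain ⟨y, hy, hy'⟩ : ∃ y : Run A B disjSat c,
      (∀ p, (∀ t, ∃ u ≥ t, M p u) → ∀ t, ∃ u ≥ t, y.mv u = p) ∧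
      ∀ t, ∃ u, ∀ v ≥ u, ∀ p, ∃ t' ≥ t, view (y.s v) p = view (m t') p ∧
        inp (y.e v) p = inp (me t') p := by
    refine exists_run_of_simultaneous m me M ⟨x.isInit0.1, fun k => (τ k).init⟩ ?_ ?_ ?_ ?_
    · rintro (_ | k) t h
      · exact ⟨x.view_succ (Ne.symm h), x.persist t none (Ne.symm h)⟩
      · have h1 := (τ k).idle t h
        exact ⟨congrArg Sum.inr h1.1, congrArg Sum.inr h1.2⟩
    · intro t (ht : x.mv t = none)
      have h := x.steps t
      rw [ht] at h
      obtain ⟨g, q, hg, ⟨_, ⟨p, hp, rfl⟩, hpg⟩, hs⟩ := h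
      have hq : (m (t + 1)).1 = q := congrArg Prod.fst hs
      refine ⟨g, hq ▸ hg, ?_⟩
      by_cases hu : g = Set.univ
      · exact ⟨some ⟨0, hc⟩, by simp, by simp [hu]⟩
      · rcases p with _ | j
        · exact absurd rfl hp
        obtain ⟨k, -, hk⟩ := h_wit' g (Or.inl ⟨_, _, _, hg⟩) hu t j (by simp [ht]) hpg
        exact ⟨some k, by simp, hk⟩
    · intro t k hk
      obtain ⟨i, hi, h1, h2, h3⟩ := (τ k).follow t hk
      have h := x.steps t
      rw [hi] at h
      obtain ⟨g, q, hg, ⟨_, ⟨p, hp, rfl⟩, hpg⟩, hs⟩ := h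
      have hq : (τ k).st (t + 1) = q := by rw [h3, hs]; simp
      refine ⟨g, ?_, ?_⟩
      · simp only [m, me, h1, h2, hq]
        exact hg
      by_cases hu : g = Set.univ
      · exact ⟨none, by simp, by simp [hu]⟩
      · rcases p with _ | j
        · refine ⟨none, by simp, hpg, ?_⟩
          have h4 := x.view_succ (t := t) (p := none) (by simp [hi])
          exact (h4 ▸ hpg : view (x.s (t + 1)) none ∈ g)
        · obtain ⟨k', hk', h4⟩ :=
            h_wit' g (Or.inr ⟨_, _, _, hg⟩) hu t j (by rw [hi]; exact hp.symm) hpg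
          refine ⟨some k', ?_, h4⟩
          rintro h5
          obtain rfl := Option.some_injective _ h5
          exact hk' hk
    · obtain ⟨p, hp⟩ := x.exists_mv_infinitely_often
      rcases p with _ | j
      · exact ⟨none, hp⟩
      · obtain ⟨k, hk⟩ := h_inf ⟨j, hp⟩
        exact ⟨some k, hk⟩
  refine ⟨y, hy none, fun k => hy (some k), fun t => ?_⟩
  obtain ⟨u, hu⟩ := hy' t
  refine ⟨u, fun v hv => ⟨?_, fun k => ?_⟩⟩
  · obtain ⟨t', ht', h1, h2⟩ := hu v hv none
    exact ⟨t', ht', Sum.inl_injective h1, Sum.inl_injective h2⟩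
  · obtain ⟨t', ht', h1, h2⟩ := hu v hv (some k)
    exact ⟨t', ht', Sum.inr_injective h1, Sum.inr_injective h2⟩

/-- A strong-fair locally deadlocked run of `n` processes is imitated by as many tracks as there
are states of `B` and non-trivial guards, plus one. -/
theorem exists_locked_run_of_equiv [Finite QB] {c : ℕ}
    (ε : Fin c ≃ QB ⊕ ↥(ntGuards A ∪ ntGuards B) ⊕ Unit) {x : Run A B disjSat n} {T : ℕ}
    (hT : ∀ R, Settled x R T) (hx : strongFair A B disjSat x)
    {γ : Fin n → Set (QA ⊕ QB)}
    (hγ : ∀ s ∈ SelfEnabled x T, γ s ∈ ntGuards A ∪ ntGuards B ∧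
      Sum.inr ((x.s T).2 s) ∈ γ s ∧ ∀ t ≥ T, ∀ p ≠ some s, view (x.s t) p ∉ γ s)
    (hγ_inj : Set.InjOn γ (SelfEnabled x T)) (hR : (SelfEnabled x T)ᶜ.Nonempty)
    {p₀ : Proc n} (hp₀ : lockedFrom A B disjSat x p₀) :
    ∃ y : Run A B disjSat c, strongFair A B disjSat y ∧ ∃ p, lockedFrom A B disjSat y p := by
  set R := (SelfEnabled x T)ᶜ with hR_def
  have hS : ∀ {s}, s ∉ R ↔ s ∈ SelfEnabled x T := by simp [hR_def]
  have h := hT R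
  obtain ⟨τ', o', h_good, h_mirror, h_unique, h_own, h_wit, h_stuck, h_inf⟩ :=
    h.exists_tracks hx hR (ntGuards A ∪ ntGuards B) γ (fun s hs => (hγ s (hS.1 hs)).1)
      (fun s hs s' hs' => hγ_inj (hS.1 hs) (hS.1 hs'))
      (fun s hs t ht j hj => (hγ s (hS.1 hs)).2.2 t ht (some j)
        (fun h1 => hs (Option.some_injective _ h1 ▸ hj)))
  let τ : Fin c → Track x := fun k => τ' (ε k)
  let o : Fin c → Option (Fin n) := fun k => o' (ε k)
  have hc : 0 < c := (ε.symm (Sum.inr (Sum.inr ()))).pos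
  have h_wit' : ∀ g ∈ ntGuards A ∪ ntGuards B, ∀ t j, x.mv t ≠ some j →
      Sum.inr ((x.s t).2 j) ∈ g → ∃ k, ¬ (τ k).act t ∧ Sum.inr ((τ k).st t) ∈ g := by
    intro g hg t j hj hjg
    by_cases hjR : j ∈ R
    · obtain ⟨k, hk⟩ := h_wit g hg t j hjR hj hjg
      exact ⟨ε.symm k, by simpa [τ] using hk⟩
    · obtain ⟨k, hk⟩ := h_own j hjR
      refine ⟨ε.symm k, ?_⟩
      simp only [τ, Equiv.apply_symm_apply, (h_mirror k j hk).2]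
      exact ⟨hj, hjg⟩
  have h_inf' : (∃ j, ∀ t, ∃ u ≥ t, x.mv u = some j) → ∃ k, ∀ t, ∃ u ≥ t, (τ k).act u := by
    rintro ⟨j, hj⟩
    have hjR : j ∈ R := by
      intro hs
      obtain ⟨u, hu, h1⟩ := hj T
      exact h.not_mv hs.1 hu h1
    obtain ⟨k, hk⟩ := h_inf ⟨j, hjR, hj⟩
    exact ⟨ε.symm k, by simpa [τ] using hk⟩
  obtain ⟨y, hyA, hyB, hy⟩ := exists_run_of_tracks hc x τ h_wit' h_inf'
  have h_view : ∀ t ≥ T, ∀ k, ∃ u ≥ T, ∃ j, (τ k).st t = (x.s u).2 j ∧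
      (o k = none ∧ j ∈ R ∨ o k = some j) := by
    intro t ht k
    rcases ho : o k with _ | s
    · obtain ⟨j, hj, u, hu, h1⟩ := (h_good (ε k) ho).late t ht
      exact ⟨u, hu, j, h1, Or.inl ⟨rfl, hj⟩⟩
    · refine ⟨t, ht, s, ?_, Or.inr rfl⟩
      simp only [τ, (h_mirror (ε k) s ho).2]
      rfl
  obtain ⟨U, hU⟩ := hy T
  have h_lockA : lockedFrom A B disjSat x none → lockedFrom A B disjSat y none := by
    intro hl
    have h_const : ∀ t ≥ T, (x.s t).1 = (x.s T).1 ∧ (x.e t).1 = (x.e T).1 := fun t ht =>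
      have h1 := x.const_of_not_mv (fun _ hu => h.not_mv hl hu) ht
      ⟨Sum.inl_injective h1.1, Sum.inl_injective h1.2⟩
    refine ⟨U, fun v hv ⟨g, q, hg, _, ⟨p, hp, rfl⟩, hpg⟩ => ?_⟩
    obtain ⟨⟨t, ht, h1, h2⟩, h3⟩ := hU v hv
    rw [h1, h2, (h_const t ht).1, (h_const t ht).2] at hg
    rcases p with _ | k
    · exact hp rfl
    obtain ⟨t', ht', h4, -⟩ := h3 k
    obtain ⟨u, hu, j, h5, -⟩ := h_view t' ht' k
    refine h.locked none hl u hu ⟨g, q, ?_, _, ⟨some j, by simp, rfl⟩, ?_⟩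
    · rw [(h_const u hu).1, (h_const u hu).2]
      exact hg
    · rw [view, ← h5, ← h4]
      exact hpg
  have h_lockB : ∀ k i, lockedFrom A B disjSat x (some i) →
      (∀ t ≥ T, (τ k).st t = (x.s T).2 i ∧ (τ k).ip t = (x.e T).2 i) →
      (∀ k' ≠ k, o k' ≠ some i) → lockedFrom A B disjSat y (some k) := by
    intro k i hl hk h_ne
    refine ⟨U, fun v hv ⟨g, q, hg, _, ⟨p, hp, rfl⟩, hpg⟩ => ?_⟩
    obtain ⟨⟨t₀, ht₀, h0, -⟩, h1⟩ := hU v hv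
    obtain ⟨t, ht, h2, h3⟩ := h1 k
    rw [h2, h3, (hk t ht).1, (hk t ht).2] at hg
    rcases p with _ | k'
    · rw [view, h0] at hpg
      exact h.not_mem_of_trans hl hg ht₀ (p := none) (by simp) hpg
    obtain ⟨t', ht', h4, -⟩ := h1 k'
    obtain ⟨u, hu, j, h5, h6⟩ := h_view t' ht' k'
    rw [view, h4, h5] at hpg
    by_cases hji : j = i
    · subst hji
      rcases h6 with ⟨-, hj⟩ | h6
      · rw [(h.state_eq hl hu).1] at hpg
        exact hj ⟨hl, g, q, hg, hpg⟩
      · exact h_ne k' (fun h7 => hp (by rw [h7])) h6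
    · exact h.not_mem_of_trans hl hg hu (p := some j) (by simpa using hji) hpg
  have h_lockR : ∀ k, o k = none → (¬ ∀ t, ∃ u ≥ t, (τ k).act u) →
      lockedFrom A B disjSat y (some k) := by
    intro k ho hk
    obtain ⟨i, hi, hl, h1⟩ := (h_good (ε k) ho).fair.resolve_left hk
    exact h_lockB k i hl h1 (fun k' _ ho' => (h_mirror (ε k') i ho').1 hi)
  have h_lockS : ∀ k s, o k = some s → lockedFrom A B disjSat y (some k) := by
    intro k s ho
    have h1 := h_mirror (ε k) s ho
    have hl := (hS.1 h1.1).1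
    refine h_lockB k s hl (fun t ht => ?_)
      (fun k' hk' ho' => hk' (ε.injective (h_unique _ _ s ho' ho)))
    simp only [τ, h1.2]
    exact h.state_eq hl ht
  refine ⟨y, fun p hp => ?_, ?_⟩
  · have h_not : ¬ lockedFrom A B disjSat y p := by
      rintro ⟨t, ht⟩
      obtain ⟨u, hu, h1⟩ := hp t
      exact ht u hu h1
    rcases p with _ | k
    · exact hyA (mv_of_not_locked hx fun h1 => h_not (h_lockA h1))
    · refine hyB k ?_
      by_contra h1
      rcases ho : o k with _ | s
      · exact h_not (h_lockR k ho h1)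
      · exact h_not (h_lockS k s ho)
  · rcases p₀ with _ | j
    · exact ⟨none, h_lockA hp₀⟩
    by_cases hj : j ∈ R
    · obtain ⟨k, hk, h1⟩ := h_stuck j hj hp₀
      exact ⟨some (ε.symm k), h_lockR _ (by simpa [o] using hk) (by simpa [τ] using h1)⟩
    · obtain ⟨k, hk⟩ := h_own j hj
      exact ⟨some (ε.symm k), h_lockS _ j (by simpa [o] using hk)⟩

end Fairness

/-- **Bounding Lemma (local deadlocks, disjunctive, fair).**
For `n ≥ |B| + |G| + 1`: if `(A,B)^{(1,n)}` has a strong-fair locally deadlocked run,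
then so does `(A,B)^{(1,|B|+|G|+1)}`. -/
theorem disjunctive_bounding_local_deadlock_fair
    (QA QB SA SB : Type) [Fintype QA] [Fintype QB] [Fintype SA] [Fintype SB]
    (A : Template QA SA (Set (QA ⊕ QB))) (B : Template QB SB (Set (QA ⊕ QB)))
    (n : ℕ) (hn : Fintype.card QB + numG A B + 1 ≤ n)
    (hx : ∃ x : Run A B disjSat n, strongFair A B disjSat x ∧
      ∃ p, lockedFrom A B disjSat x p) :
    ∃ x : Run A B disjSat (Fintype.card QB + numG A B + 1), strongFair A B disjSat x ∧
      ∃ p, lockedFrom A B disjSat x p := by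
  obtain ⟨x, hx, p₀, hp₀⟩ := hx
  obtain ⟨T, hT⟩ := exists_settled x
  obtain ⟨γ, hγ⟩ := (hT Set.univ).exists_private_guards
  have hγ_inj : Set.InjOn γ (SelfEnabled x T) := by
    intro s hs s' hs' h
    by_contra h_ne
    refine (hγ s' hs').2.2 T le_rfl (some s) (by simpa using h_ne) ?_
    rw [← h]
    exact (hγ s hs).2.1
  have hR : (SelfEnabled x T)ᶜ.Nonempty := by
    by_contra h
    rw [Set.not_nonempty_iff_eq_empty, Set.compl_empty_iff] at h
    have h1 := Set.ncard_le_ncard_of_injOn γ (fun s hs => (hγ s hs).1) hγ_inj (Set.toFinite _)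
    rw [h, Set.ncard_univ, Nat.card_eq_fintype_card, Fintype.card_fin] at h1
    unfold numG at hn
    omega
  have h_card : Nat.card (QB ⊕ ↥(ntGuards A ∪ ntGuards B) ⊕ Unit) =
      Fintype.card QB + numG A B + 1 := by
    rw [Nat.card_sum, Nat.card_sum, Nat.card_coe_set_eq, Nat.card_eq_fintype_card, numG]
    simp [add_assoc]
  exact exists_locked_run_of_equiv (Finite.equivFinOfCardEq h_card).symm hT hx hγ hγ_inj hR hp₀

end GP
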